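/- arXiv:math/0110091 — 2 statements merged into one kernel-verified Lean document; each statement's English description precedes it below -/
import Mathlib

section
/- Let Γ = {Δ₁,…,Δ_N} be a semi-stable simplicial partition of an n-dimensional simplicial rational polytope Δ ⊂ ℝⁿ. For any vertex p of Γ (i.e., a vertex of some Δ_j that is not a vertex of Δ), there are exactly n + 1 edges of Γ containing p. -/
open Set

noncomputable section

/-- Cast an integer vector to a real vector. -/
def castVec {n : ℕ} (v : Fin n → ℤ) : Fin n → ℝ := fun i => (v i : ℝ)

/-- Cast a rational vector to a real vector. -/
def castQVec {n : ℕ} (v : Fin n → ℚ) : Fin n → ℝ := fun i => (v i : ℝ)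

/-- A rational polytope: the convex hull of finitely many rational points. -/
def IsRatPolytope {n : ℕ} (P : Set (Fin n → ℝ)) : Prop :=
  ∃ S : Finset (Fin n → ℚ), P = convexHull ℝ (castQVec '' (S : Set (Fin n → ℚ)))

/-- An integral polytope: the convex hull of finitely many lattice points. -/
def IsIntegralPolytope {n : ℕ} (P : Set (Fin n → ℝ)) : Prop :=
  ∃ S : Finset (Fin n → ℤ), P = convexHull ℝ (castVec '' (S : Set (Fin n → ℤ)))

/-- The dimension of a set: the dimension of (the direction of) its affine span. -/
def polyDim {n : ℕ} (P : Set (Fin n → ℝ)) : ℕ :=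
  Module.finrank ℝ (vectorSpan ℝ P)

/-- Faces of a polytope/polyhedron: intersections with supporting hyperplanes, together
with the set itself. -/
def IsFaceOf {n : ℕ} (F P : Set (Fin n → ℝ)) : Prop :=
  F = P ∨ ∃ (f : (Fin n → ℝ) →ₗ[ℝ] ℝ) (c : ℝ),
    (∀ x ∈ P, f x ≤ c) ∧ F = {x ∈ P | f x = c} ∧ F.Nonempty

/-- A vertex is a 0-dimensional (i.e. singleton) face. -/
def IsVertexOf {n : ℕ} (p : Fin n → ℝ) (P : Set (Fin n → ℝ)) : Prop := IsFaceOf {p} P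

/-- An edge is a 1-dimensional face. -/
def IsEdgeOf {n : ℕ} (e P : Set (Fin n → ℝ)) : Prop := IsFaceOf e P ∧ polyDim e = 1

/-- A `k`-dimensional polytope is simplicial if exactly `k` edges meet at each vertex. -/
def IsSimplicial {n : ℕ} (k : ℕ) (P : Set (Fin n → ℝ)) : Prop :=
  ∀ p, IsVertexOf p P → {e | IsEdgeOf e P ∧ p ∈ e}.ncard = k

/-- A simplicial partition of a `k`-dimensional simplicial rational polytope `Δ ⊆ ℝⁿ`:
finitely many `k`-dimensional simplicial rational polytopes whose union is `Δ` and
such that the intersection of any two of them is a (possibly empty) common face. -/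
structure SimplicialPartition (n k N : ℕ) (Δ : Set (Fin n → ℝ)) : Type where
  pieces : Fin N → Set (Fin n → ℝ)
  piece_rat : ∀ j, IsRatPolytope (pieces j)
  piece_dim : ∀ j, polyDim (pieces j) = k
  piece_simplicial : ∀ j, IsSimplicial k (pieces j)
  covers : ⋃ j, pieces j = Δ
  common_face : ∀ i j, i ≠ j → pieces i ∩ pieces j = ∅ ∨
    (IsFaceOf (pieces i ∩ pieces j) (pieces i) ∧ IsFaceOf (pieces i ∩ pieces j) (pieces j))

variable {n k N : ℕ} {Δ : Set (Fin n → ℝ)}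

/-- A face of the partition `Γ`: a face of one of the subpolytopes, where the
vertices of `Δ` are excluded as 0-faces. -/
def IsGammaFace (Γ : SimplicialPartition n k N Δ) (σ : Set (Fin n → ℝ)) : Prop :=
  (∃ j, IsFaceOf σ (Γ.pieces j)) ∧ ∀ v : Fin n → ℝ, σ = {v} → ¬ IsVertexOf v Δ

/-- A vertex of the partition `Γ`: a vertex of some subpolytope which is not a vertex of `Δ`. -/
def IsGammaVertex (Γ : SimplicialPartition n k N Δ) (p : Fin n → ℝ) : Prop :=
  (∃ j, IsVertexOf p (Γ.pieces j)) ∧ ¬ IsVertexOf p Δ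

/-- An edge of the partition `Γ`. -/
def IsGammaEdge (Γ : SimplicialPartition n k N Δ) (e : Set (Fin n → ℝ)) : Prop :=
  (∃ j, IsFaceOf e (Γ.pieces j)) ∧ polyDim e = 1

/-- `Γ` is semi-stable: for each face `σ` of `Γ`, if `τ` is the smallest face of `Δ`
containing `σ`, then exactly `dim τ − dim σ + 1` of the subpolytopes have `σ` as a face. -/
def IsSemiStable (Γ : SimplicialPartition n k N Δ) : Prop :=
  ∀ σ, IsGammaFace Γ σ →
    ∀ τ, IsFaceOf τ Δ → σ ⊆ τ → (∀ τ', IsFaceOf τ' Δ → σ ⊆ τ' → τ ⊆ τ') →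
      {j | IsFaceOf σ (Γ.pieces j)}.ncard = polyDim τ - polyDim σ + 1

/-- `v` is the primitive vector of the edge `σ` at its vertex `p`: the shortest nonzero
lattice vector on the ray from `p` along `σ`. -/
def IsPrimitiveEdgeVector {n : ℕ} (σ : Set (Fin n → ℝ)) (p : Fin n → ℝ) (v : Fin n → ℤ) : Prop :=
  v ≠ 0 ∧ (∃ t : ℝ, 0 < t ∧ p + t • castVec v ∈ σ) ∧
    ∀ w : Fin n → ℤ, w ≠ 0 → (∃ s : ℝ, 0 < s ∧ castVec w = s • castVec v) →
      ∃ m : ℕ, 1 ≤ m ∧ w = (m : ℤ) • v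

/-- A vertex `p` of a full-dimensional simplicial integral polytope `P ⊆ ℝⁿ` is non-singular
if the primitive vectors of the `n` edges of `P` at `p` form a `ℤ`-basis of `ℤⁿ`. -/
def IsNonsingularVertexOf {n : ℕ} (p : Fin n → ℝ) (P : Set (Fin n → ℝ)) : Prop :=
  IsVertexOf p P ∧
  ∃ (e : Fin n → Set (Fin n → ℝ)) (v : Fin n → Fin n → ℤ),
    Function.Injective e ∧
    (∀ i, IsEdgeOf (e i) P ∧ p ∈ e i ∧ IsPrimitiveEdgeVector (e i) p (v i)) ∧
    (∀ e', IsEdgeOf e' P → p ∈ e' → ∃ i, e' = e i) ∧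
    Submodule.span ℤ (Set.range v) = ⊤

/-- A non-singular polytope: integral, simplicial, and all vertices non-singular. -/
def IsNonsingularPolytope {n : ℕ} (k : ℕ) (P : Set (Fin n → ℝ)) : Prop :=
  IsIntegralPolytope P ∧ IsSimplicial k P ∧ ∀ p, IsVertexOf p P → IsNonsingularVertexOf p P

/-- A non-singular partition: `Δ` and all the subpolytopes are integral, and every vertex
of `Γ` is a non-singular vertex of every subpolytope containing it. -/
def IsNonsingularPartition (Γ : SimplicialPartition n k N Δ) : Prop :=
  IsIntegralPolytope Δ ∧ (∀ j, IsIntegralPolytope (Γ.pieces j)) ∧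
    ∀ p, IsGammaVertex Γ p → ∀ j, p ∈ Γ.pieces j → IsNonsingularVertexOf p (Γ.pieces j)

/-- An edge of the restricted partition `Γ ∩ τ`. -/
def IsRestrictedEdge (Γ : SimplicialPartition n k N Δ) (τ σ : Set (Fin n → ℝ)) : Prop :=
  ∃ j, IsFaceOf σ (Γ.pieces j ∩ τ) ∧ polyDim σ = 1

/-- A maximal vertex of `Γ`: a vertex of `Γ` lying in the relative interior of a face of `Δ`
of the largest possible dimension among faces of `Δ` containing vertices of `Γ` in their
relative interiors. -/
def IsMaximalVertex (Γ : SimplicialPartition n k N Δ) (p : Fin n → ℝ) : Prop :=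
  IsGammaVertex Γ p ∧ ∃ τ, IsFaceOf τ Δ ∧ p ∈ intrinsicInterior ℝ τ ∧
    ∀ (q : Fin n → ℝ) (τ' : Set (Fin n → ℝ)), IsGammaVertex Γ q → IsFaceOf τ' Δ →
      q ∈ intrinsicInterior ℝ τ' → polyDim τ' ≤ polyDim τ

/-- `Γ` is balanced: at each vertex `p` of `Γ`, lying in the relative interior of an
`l`-dimensional face `τ` of `Δ`, any relation `∑ wᵢ σᵢ(p) = 0` with positive weights of
gcd 1 among the primitive vectors of the `l+1` edges of `Γ ∩ τ` at `p` has all weights 1. -/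
def IsBalanced (Γ : SimplicialPartition n k N Δ) : Prop :=
  ∀ p, IsGammaVertex Γ p → ∀ (l : ℕ) (τ : Set (Fin n → ℝ)),
    IsFaceOf τ Δ → polyDim τ = l → p ∈ intrinsicInterior ℝ τ →
    ∀ (σ : Fin (l+1) → Set (Fin n → ℝ)) (v : Fin (l+1) → Fin n → ℤ) (w : Fin (l+1) → ℤ),
      Function.Injective σ →
      (∀ i, IsRestrictedEdge Γ τ (σ i) ∧ p ∈ σ i ∧ IsPrimitiveEdgeVector (σ i) p (v i)) →
      (∀ e, IsRestrictedEdge Γ τ e → p ∈ e → ∃ i, e = σ i) →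
      (∀ i, 0 < w i) → Finset.univ.gcd w = 1 → (∑ i, w i • v i) = 0 →
      ∀ i, w i = 1

/-- `Γ` is mildly singular: balanced seim-stable and all maximal vertices are non-singular. -/
def IsMildlySingular (Γ : SimplicialPartition n k N Δ) : Prop :=
  IsBalanced Γ ∧
    ∀ p, IsMaximalVertex Γ p → ∀ j, p ∈ Γ.pieces j → IsNonsingularVertexOf p (Γ.pieces j)

/-- An affine function with rational coefficients. -/
def IsRatAffine {n : ℕ} (f : (Fin n → ℝ) →ᵃ[ℝ] ℝ) : Prop :=
  ∃ (a : Fin n → ℚ) (b : ℚ), ∀ x : Fin n → ℝ, f x = (∑ i, (a i : ℝ) * x i) + (b : ℝ)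

/-- `f = f_{ij,p}`: the affine function vanishing on the hyperplane containing the
`(n−1)`-face `Δᵢ ∩ Δⱼ` of `Γ` and taking value 1 at `p + τ₀(p)`, where `τ₀` is the
(unique) edge of `Γ` at `p` not contained in `Δᵢ`. -/
def IsNormalizedAffine (Γ : SimplicialPartition n k N Δ) (i j : Fin N) (p : Fin n → ℝ)
    (f : (Fin n → ℝ) →ᵃ[ℝ] ℝ) : Prop :=
  (∀ x, x ∈ affineSpan ℝ (Γ.pieces i ∩ Γ.pieces j) → f x = 0) ∧
  ∃ (τ₀ : Set (Fin n → ℝ)) (v : Fin n → ℤ),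
    IsGammaEdge Γ τ₀ ∧ p ∈ τ₀ ∧ ¬ τ₀ ⊆ Γ.pieces i ∧
    IsPrimitiveEdgeVector τ₀ p v ∧ f (p + castVec v) = 1

/-- The data entering the concavity `C(f,p)` of a piecewise affine function at a vertex `p`
of `Γ`: the face `τ` of `Δ` with `p` in its relative interior, the `l+1` edges `σᵢ` of
`Γ ∩ τ` at `p`, their primitive vectors `vᵢ` and subpolytopes `Δ_{jsᵢ}` having `σᵢ` as
an edge. -/
def ConcavityDatum (Γ : SimplicialPartition n k N Δ) (p : Fin n → ℝ) (l : ℕ)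
    (τ : Set (Fin n → ℝ)) (σ : Fin (l+1) → Set (Fin n → ℝ))
    (v : Fin (l+1) → Fin n → ℤ) (js : Fin (l+1) → Fin N) : Prop :=
  IsFaceOf τ Δ ∧ polyDim τ = l ∧ p ∈ intrinsicInterior ℝ τ ∧
  Function.Injective σ ∧
  (∀ i, IsFaceOf (σ i) (Γ.pieces (js i) ∩ τ) ∧ polyDim (σ i) = 1 ∧ p ∈ σ i ∧
    IsPrimitiveEdgeVector (σ i) p (v i)) ∧
  (∀ e, IsRestrictedEdge Γ τ e → p ∈ e → ∃ i, e = σ i)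

/-- The concavity `C(f,p) = ∑ᵢ (fᵢ(p + σᵢ(p)) − fᵢ(p))` of the piecewise affine function
with affine pieces `g j` at the vertex `p`, for given concavity data. -/
def concavitySum (Γ : SimplicialPartition n k N Δ) (g : Fin N → ((Fin n → ℝ) →ᵃ[ℝ] ℝ))
    (p : Fin n → ℝ) {l : ℕ} (v : Fin (l+1) → Fin n → ℤ) (js : Fin (l+1) → Fin N) : ℝ :=
  ∑ i, (g (js i) (p + castVec (v i)) - g (js i) p)

/-- Projection ℝ^{n+1} → ℝⁿ forgetting the 0-th (extra) coordinate. -/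
def projDown {n : ℕ} (z : Fin (n+1) → ℝ) : Fin n → ℝ := fun i => z i.succ

/-- The lifted polyhedron `Δ̃ = {(y,x) ∈ ℝ × Δ : y ≥ F(x)}`. -/
def liftSet {n : ℕ} (Δ : Set (Fin n → ℝ)) (F : (Fin n → ℝ) → ℝ) : Set (Fin (n+1) → ℝ) :=
  {z | projDown z ∈ Δ ∧ F (projDown z) ≤ z 0}

/-- A polyhedron: a finite intersection of closed half-spaces. -/
def IsPolyhedron {m : ℕ} (P : Set (Fin m → ℝ)) : Prop :=
  ∃ (s : ℕ) (a : Fin s → ((Fin m → ℝ) →ₗ[ℝ] ℝ)) (c : Fin s → ℝ),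
    P = {x | ∀ i, a i x ≤ c i}

/-- The part of a convex hull lying in a supporting hyperplane is the convex hull of the
generators lying in that hyperplane. -/
theorem mem_convexHull_of_eq_bound {E : Type*} [AddCommGroup E] [Module ℝ E] {T : Set E}
    (f : E →ₗ[ℝ] ℝ) {c : ℝ} (hT : ∀ x ∈ T, f x ≤ c) {x : E} (hx : x ∈ convexHull ℝ T)
    (hfx : f x = c) : x ∈ convexHull ℝ {y ∈ T | f y = c} := by
  have hconv : Convex ℝ {x : E | f x ≤ c ∧ (f x = c → x ∈ convexHull ℝ {y ∈ T | f y = c})} := by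
    rintro x ⟨hx, hx'⟩ y ⟨hy, hy'⟩ a b ha hb hab
    have key : c - f (a • x + b • y) = a * (c - f x) + b * (c - f y) := by
      simp only [map_add, map_smul, smul_eq_mul]
      linear_combination -c * hab
    have h1 : 0 ≤ a * (c - f x) := mul_nonneg ha (by linarith)
    have h2 : 0 ≤ b * (c - f y) := mul_nonneg hb (by linarith)
    refine ⟨by linarith, fun h => ?_⟩
    have h1' : a * (c - f x) = 0 := by linarith
    have h2' : b * (c - f y) = 0 := by linarith
    rcases mul_eq_zero.1 h1' with rfl | h1'
    · obtain rfl : b = 1 := by linarith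
      simpa using hy' (by simpa using h)
    rcases mul_eq_zero.1 h2' with rfl | h2'
    · obtain rfl : a = 1 := by linarith
      simpa using hx' (by simpa using h)
    exact convex_convexHull ℝ _ (hx' (by linarith)) (hy' (by linarith)) ha hb hab
  have hsub : T ⊆ {x : E | f x ≤ c ∧ (f x = c → x ∈ convexHull ℝ {y ∈ T | f y = c})} :=
    fun y hy => ⟨hT y hy, fun h => subset_convexHull ℝ _ ⟨hy, h⟩⟩
  exact (convexHull_min hsub hconv hx).2 hfx

/-- An extreme point of the convex hull of a finite set is a strict maximum, over that set,
of some linear functional. -/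
theorem exists_linearMap_lt_of_mem_extremePoints {T : Set (Fin n → ℝ)} (hT : T.Finite)
    {p : Fin n → ℝ} (hp : p ∈ (convexHull ℝ T).extremePoints ℝ) :
    ∃ f : (Fin n → ℝ) →ₗ[ℝ] ℝ, ∀ x ∈ T, x ≠ p → f x < f p := by
  have h := (Convex.mem_extremePoints_iff_mem_sdiff_convexHull_sdiff
    (convex_convexHull ℝ T)).1 hp
  have hnot : p ∉ convexHull ℝ (T \ {p}) := fun h' =>
    h.2 (convexHull_mono (sdiff_le_sdiff_right (subset_convexHull ℝ T)) h')
  obtain ⟨f, u, hf, hu⟩ := geometric_hahn_banach_closed_point (convex_convexHull ℝ _)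
    ((hT.subset sdiff_subset).isClosed_convexHull ℝ) hnot
  exact ⟨f, fun x hx hxp => (hf x (subset_convexHull ℝ _ ⟨hx, hxp⟩)).trans hu⟩

theorem IsFaceOf.subset {F P : Set (Fin n → ℝ)} (h : IsFaceOf F P) : F ⊆ P := by
  rcases h with rfl | ⟨f, c, -, rfl, -⟩
  · exact Subset.rfl
  · exact fun x hx => hx.1

theorem IsFaceOf.isExtreme {F P : Set (Fin n → ℝ)} (h : IsFaceOf F P) : IsExtreme ℝ P F := by
  rcases h with rfl | ⟨f, c, hf, rfl, -⟩
  · exact IsExtreme.rfl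
  · refine ⟨fun x hx => hx.1, fun x hx y hy z hz hzxy => ⟨hx, ?_⟩⟩
    obtain ⟨a, b, ha, hb, hab, rfl⟩ := hzxy
    have h1 := hz.2
    simp only [map_add, map_smul, smul_eq_mul] at h1
    have hx' := hf x hx
    have hy' := mul_le_mul_of_nonneg_left (hf y hy) hb.le
    have : a * c ≤ a * f x := by
      have : a * c + b * c = c := by rw [← add_mul, hab, one_mul]
      linarith
    exact le_antisymm hx' (le_of_mul_le_mul_left this ha)

theorem IsVertexOf.mem_extremePoints {p : Fin n → ℝ} {P : Set (Fin n → ℝ)}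
    (h : IsVertexOf p P) : p ∈ P.extremePoints ℝ :=
  isExtreme_singleton.1 (IsFaceOf.isExtreme h)

theorem IsRatPolytope.exists_finite {P : Set (Fin n → ℝ)} (h : IsRatPolytope P) :
    ∃ T : Set (Fin n → ℝ), T.Finite ∧ P = convexHull ℝ T := by
  obtain ⟨S, hS⟩ := h
  exact ⟨_, S.finite_toSet.image _, hS⟩

theorem isVertexOf_of_mem_extremePoints {P : Set (Fin n → ℝ)} (hP : IsRatPolytope P)
    {p : Fin n → ℝ} (hp : p ∈ P.extremePoints ℝ) : IsVertexOf p P := by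
  obtain ⟨T, hT, rfl⟩ := hP.exists_finite
  obtain ⟨f, hf⟩ := exists_linearMap_lt_of_mem_extremePoints hT hp
  have hle : ∀ x ∈ T, f x ≤ f p := fun x hx => by
    rcases eq_or_ne x p with rfl | h
    · exact le_rfl
    · exact (hf x hx h).le
  refine Or.inr ⟨f, f p, ?_, ?_, singleton_nonempty p⟩
  · exact fun x hx => convexHull_min hle (convex_halfSpace_le f.isLinear (f p)) hx
  · refine Subset.antisymm (singleton_subset_iff.2 ⟨hp.1, rfl⟩) fun x hx => ?_
    have h1 := mem_convexHull_of_eq_bound f hle hx.1 hx.2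
    refine convexHull_min (fun y hy => ?_) (convex_singleton p) h1
    by_contra hyp
    exact (hf y hy.1 hyp).ne hy.2

theorem IsFaceOf.inter {F G P : Set (Fin n → ℝ)} (hF : IsFaceOf F P) (hG : IsFaceOf G P)
    (hne : (F ∩ G).Nonempty) : IsFaceOf (F ∩ G) P := by
  rcases hF with rfl | ⟨f, c, hf, rfl, -⟩
  · rwa [inter_eq_right.2 hG.subset]
  rcases hG with rfl | ⟨g, d, hg, rfl, -⟩
  · rw [inter_eq_left.2 (sep_subset _ _)]
    exact Or.inr ⟨f, c, hf, rfl, hne.left⟩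
  refine Or.inr ⟨f + g, c + d, fun x hx => add_le_add (hf x hx) (hg x hx), ?_, hne⟩
  ext x
  constructor
  · rintro ⟨⟨hx, h1⟩, -, h2⟩
    exact ⟨hx, by simp [h1, h2]⟩
  · rintro ⟨hx, h⟩
    have h1 := hf x hx
    have h2 := hg x hx
    simp only [LinearMap.add_apply] at h
    exact ⟨⟨hx, by linarith⟩, hx, by linarith⟩

theorem polyDim_mono {F G : Set (Fin n → ℝ)} (h : F ⊆ G) : polyDim F ≤ polyDim G :=
  Submodule.finrank_mono (vectorSpan_mono ℝ h)

theorem IsFaceOf.eq_of_polyDim_le {F G P : Set (Fin n → ℝ)} (hF : IsFaceOf F P)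
    (hGP : G ⊆ P) (hFG : F ⊆ G) (hne : F.Nonempty) (hdim : polyDim G ≤ polyDim F) :
    F = G := by
  rcases hF with rfl | ⟨f, c, hf, rfl, -⟩
  · exact hFG.antisymm hGP
  refine hFG.antisymm fun x hx => ⟨hGP hx, ?_⟩
  have hspan := Submodule.eq_of_le_of_finrank_le (vectorSpan_mono ℝ hFG) hdim
  obtain ⟨y, hy⟩ := hne
  have hxy : x -ᵥ y ∈ vectorSpan ℝ {x ∈ P | f x = c} :=
    hspan ▸ vsub_mem_vectorSpan ℝ hx (hFG hy)
  have hker : vectorSpan ℝ {x ∈ P | f x = c} ≤ LinearMap.ker f := by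
    rw [vectorSpan, Submodule.span_le]
    rintro _ ⟨a, ha, b, hb, rfl⟩
    simp [ha.2, hb.2]
  have := hker hxy
  simp only [vsub_eq_sub, LinearMap.mem_ker, map_sub, hy.2] at this
  linarith

/-- Every nonempty subset of a set has a smallest face containing it. -/
theorem exists_least_face {σ P : Set (Fin n → ℝ)} (hne : σ.Nonempty) (hσ : σ ⊆ P) :
    ∃ τ, IsFaceOf τ P ∧ σ ⊆ τ ∧ ∀ τ', IsFaceOf τ' P → σ ⊆ τ' → τ ⊆ τ' := by
  classical
  have hex : ∃ d, ∃ τ, IsFaceOf τ P ∧ σ ⊆ τ ∧ polyDim τ = d := ⟨_, P, Or.inl rfl, hσ, rfl⟩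
  obtain ⟨τ, h1, h2, h3⟩ := Nat.find_spec hex
  refine ⟨τ, h1, h2, fun τ' h4 h5 => ?_⟩
  have h6 : σ ⊆ τ ∩ τ' := subset_inter h2 h5
  have h7 := h1.inter h4 (hne.mono h6)
  have h8 := h7.eq_of_polyDim_le h1.subset inter_subset_left (hne.mono h6)
    (h3.trans_le (Nat.find_min' hex ⟨_, h7, h6, rfl⟩))
  exact inter_eq_left.1 h8

/-- The edges of a polytope at a vertex span the whole direction of the polytope. -/
theorem vectorSpan_le_iSup_edges {P : Set (Fin n → ℝ)} (hP : IsRatPolytope P)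
    {p : Fin n → ℝ} (hp : IsVertexOf p P) :
    vectorSpan ℝ P ≤ ⨆ e ∈ {e | IsEdgeOf e P ∧ p ∈ e}, vectorSpan ℝ e := by
  set W := ⨆ e ∈ {e | IsEdgeOf e P ∧ p ∈ e}, vectorSpan ℝ e
  obtain ⟨T, hT, rfl⟩ := hP.exists_finite
  obtain ⟨f, hf⟩ := exists_linearMap_lt_of_mem_extremePoints hT hp.mem_extremePoints
  have hpP : p ∈ convexHull ℝ T := hp.mem_extremePoints.1
  set φ : (Fin n → ℝ) → (Fin n → ℝ) := fun s => (f p - f s)⁻¹ • (s - p) with hφ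
  have hφs : ∀ s ∈ T, s ≠ p → s - p = (f p - f s) • φ s := fun s hs hsp => by
    rw [hφ, smul_inv_smul₀ (sub_pos.2 (hf s hs hsp)).ne']
  have hfin : (φ '' (T \ {p})).Finite := (hT.subset sdiff_subset).image _
  have hext : (convexHull ℝ (φ '' (T \ {p}))).extremePoints ℝ ⊆ (W : Set (Fin n → ℝ)) := by
    intro v hv
    obtain ⟨h, hh⟩ := exists_linearMap_lt_of_mem_extremePoints hfin hv
    obtain ⟨s, ⟨hs, hsp⟩, rfl⟩ := extremePoints_convexHull_subset hv
    have hsp : s ≠ p := hsp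
    set v := φ s with hvdef
    have hpos := sub_pos.2 (hf s hs hsp)
    set g : (Fin n → ℝ) →ₗ[ℝ] ℝ := h + h v • f with hg
    have hgval : ∀ t ∈ T, t ≠ p → g t - g p = (f p - f t) * (h (φ t) - h v) := by
      intro t ht htp
      have : h t - h p = (f p - f t) * h (φ t) := by
        rw [← map_sub, hφs t ht htp, map_smul, smul_eq_mul]
      simp only [hg, LinearMap.add_apply, LinearMap.smul_apply, smul_eq_mul]
      linear_combination this
    have hgle : ∀ t ∈ T, g t ≤ g p := by
      intro t ht
      rcases eq_or_ne t p with rfl | htp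
      · exact le_rfl
      have h1 := hgval t ht htp
      have h2 := sub_pos.2 (hf t ht htp)
      have h3 : h (φ t) - h v ≤ 0 := by
        rcases eq_or_ne (φ t) v with h4 | h4
        · rw [h4, sub_self]
        · exact (sub_neg.2 (hh _ ⟨t, ⟨ht, htp⟩, rfl⟩ h4)).le
      have := mul_nonpos_of_nonneg_of_nonpos h2.le h3
      linarith
    set e := {x ∈ convexHull ℝ T | g x = g p}
    have hpe : p ∈ e := ⟨hpP, rfl⟩
    have hse : s ∈ e := by
      refine ⟨subset_convexHull ℝ T hs, ?_⟩
      have := hgval s hs hsp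
      rw [← hvdef, sub_self, mul_zero] at this
      linarith
    have heL : ∀ x ∈ e, x - p ∈ Submodule.span ℝ {v} := by
      intro x hx
      have h1 := mem_convexHull_of_eq_bound g hgle hx.1 hx.2
      have h2 : Convex ℝ ((fun x => x - p) ⁻¹' (Submodule.span ℝ {v} : Set (Fin n → ℝ))) := by
        have := (Submodule.span ℝ {v}).convex.translate_preimage_left (-p)
        simpa [sub_eq_add_neg] using this
      refine convexHull_min ?_ h2 h1
      rintro t ⟨ht, hgt⟩
      rcases eq_or_ne t p with rfl | htp
      · simp
      have h3 := hgval t ht htp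
      rw [hgt, sub_self, eq_comm, mul_eq_zero] at h3
      have h4 : h (φ t) = h v := by
        rcases h3 with h3 | h3
        · exact absurd h3 (sub_pos.2 (hf t ht htp)).ne'
        · linarith
      have h5 : φ t = v := by
        by_contra h5
        exact (hh _ ⟨t, ⟨ht, htp⟩, rfl⟩ h5).ne h4
      change t - p ∈ Submodule.span ℝ {v}
      rw [hφs t ht htp, h5]
      exact Submodule.smul_mem _ _ (Submodule.mem_span_singleton_self v)
    have hve : v ∈ vectorSpan ℝ e :=
      Submodule.smul_mem _ _ (vsub_mem_vectorSpan ℝ hse hpe)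
    have hspan : vectorSpan ℝ e = Submodule.span ℝ {v} := by
      refine le_antisymm ?_ (by simpa using hve)
      rw [vectorSpan, Submodule.span_le]
      rintro _ ⟨a, ha, b, hb, rfl⟩
      have := Submodule.sub_mem _ (heL a ha) (heL b hb)
      simpa using this
    have hv0 : v ≠ 0 := by
      intro h0
      have := hφs s hs hsp
      rw [← hvdef, h0, smul_zero] at this
      exact hsp (sub_eq_zero.1 this)
    have hedge : IsEdgeOf e (convexHull ℝ T) := by
      refine ⟨Or.inr ⟨g, g p, ?_, rfl, ⟨p, hpe⟩⟩, ?_⟩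
      · exact fun x hx => convexHull_min hgle (convex_halfSpace_le g.isLinear _) hx
      · rw [polyDim, hspan, finrank_span_singleton hv0]
    exact (le_iSup₂_of_le (f := fun e _ => vectorSpan ℝ e) e ⟨hedge, hpe⟩ le_rfl) hve
  have hQ : convexHull ℝ (φ '' (T \ {p})) ⊆ (W : Set (Fin n → ℝ)) := by
    rw [← closure_convexHull_extremePoints (hfin.isCompact_convexHull ℝ) (convex_convexHull ℝ _)]
    exact closure_minimal (convexHull_min hext W.convex) W.closed_of_finiteDimensional
  rw [← direction_affineSpan, affineSpan_convexHull, direction_affineSpan, vectorSpan,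
    Submodule.span_le]
  have hTW : ∀ t ∈ T, t - p ∈ W := by
    intro t ht
    rcases eq_or_ne t p with rfl | htp
    · simp
    rw [hφs t ht htp]
    exact W.smul_mem _ (hQ (subset_convexHull ℝ _ ⟨t, ⟨ht, htp⟩, rfl⟩))
  rintro _ ⟨a, ha, b, hb, rfl⟩
  simpa using W.sub_mem (hTW a ha) (hTW b hb)

@[simp]
theorem polyDim_singleton (v : Fin n → ℝ) : polyDim {v} = 0 := by
  rw [polyDim, vectorSpan_singleton, finrank_bot]

theorem IsEdgeOf.not_singleton {e P : Set (Fin n → ℝ)} (h : IsEdgeOf e P) (v : Fin n → ℝ) :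
    e ≠ {v} := by
  rintro rfl
  have := h.2
  simp at this

theorem finrank_finset_sup_le_sum {ι V : Type*} [AddCommGroup V] [Module ℝ V]
    [FiniteDimensional ℝ V] (s : Finset ι) (W : ι → Submodule ℝ V) :
    Module.finrank ℝ ↥(s.sup W) ≤ ∑ i ∈ s, Module.finrank ℝ (W i) := by
  classical
  induction s using Finset.induction_on with
  | empty => simp
  | insert i s hi ih =>
    rw [Finset.sup_insert, Finset.sum_insert hi]
    exact (Submodule.finrank_add_le_finrank_add_finrank _ _).trans (by lia)

/-- If all but `b` of the edges of a full-dimensional polytope at a vertex lie in a set `τ`,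
then `n ≤ dim τ + b`. -/
theorem dim_le_polyDim_add_card {P : Set (Fin n → ℝ)} (hP : IsRatPolytope P)
    (hdim : polyDim P = n) {p : Fin n → ℝ} (hp : IsVertexOf p P) (τ : Set (Fin n → ℝ))
    (B : Finset (Set (Fin n → ℝ))) (hB : ∀ e, IsEdgeOf e P → p ∈ e → e ⊆ τ ∨ e ∈ B)
    (hB1 : ∀ e ∈ B, polyDim e = 1) : n ≤ polyDim τ + B.card := by
  have hle : vectorSpan ℝ P ≤ vectorSpan ℝ τ ⊔ B.sup (fun e => vectorSpan ℝ e) := by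
    refine (vectorSpan_le_iSup_edges hP hp).trans (iSup₂_le fun e he => ?_)
    rcases hB e he.1 he.2 with h | h
    · exact (vectorSpan_mono ℝ h).trans le_sup_left
    · exact (Finset.le_sup (f := fun e => vectorSpan ℝ e) h).trans le_sup_right
  calc n = Module.finrank ℝ (vectorSpan ℝ P) := hdim.symm
    _ ≤ _ := Submodule.finrank_mono hle
    _ ≤ _ := Submodule.finrank_add_le_finrank_add_finrank _ _
    _ ≤ polyDim τ + ∑ e ∈ B, Module.finrank ℝ (vectorSpan ℝ e) :=
      Nat.add_le_add_left (finrank_finset_sup_le_sum _ _) _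
    _ = polyDim τ + B.card := by
      rw [Finset.card_eq_sum_ones]
      exact congrArg _ (Finset.sum_congr rfl hB1)

theorem SimplicialPartition.piece_subset (Γ : SimplicialPartition n k N Δ) (j : Fin N) :
    Γ.pieces j ⊆ Δ :=
  (subset_iUnion Γ.pieces j).trans Γ.covers.subset

/-- A vertex of one piece is a vertex of every piece containing it. -/
theorem SimplicialPartition.isVertexOf_of_mem (Γ : SimplicialPartition n k N Δ)
    {i j : Fin N} {p : Fin n → ℝ} (hi : IsVertexOf p (Γ.pieces i)) (hj : p ∈ Γ.pieces j) :
    IsVertexOf p (Γ.pieces j) := by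
  rcases eq_or_ne i j with rfl | hij
  · exact hi
  have hpi := hi.mem_extremePoints
  have hmem : p ∈ Γ.pieces i ∩ Γ.pieces j := ⟨hpi.1, hj⟩
  rcases Γ.common_face i j hij with h | ⟨-, h⟩
  · exact absurd hmem (h ▸ notMem_empty p)
  · exact isVertexOf_of_mem_extremePoints (Γ.piece_rat j)
      (h.isExtreme.extremePoints_subset_extremePoints
        (inter_extremePoints_subset_extremePoints_of_subset inter_subset_left ⟨hmem, hpi⟩))

/-- In a semi-stable partition of positive dimension, distinct indices give distinct pieces. -/
theorem IsSemiStable.pieces_injective {Γ : SimplicialPartition n n N Δ} (hss : IsSemiStable Γ)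
    (hn : 1 ≤ n) : Function.Injective Γ.pieces := by
  intro i j hij
  have hdim := Γ.piece_dim i
  have hne : (Γ.pieces i).Nonempty := by
    by_contra h
    rw [not_nonempty_iff_eq_empty.1 h, polyDim, vectorSpan_empty, finrank_bot] at hdim
    lia
  obtain ⟨τ, h1, h2, h3⟩ := exists_least_face hne (Γ.piece_subset i)
  have hface : IsGammaFace Γ (Γ.pieces i) := by
    refine ⟨⟨i, Or.inl rfl⟩, fun v hv => ?_⟩
    rw [hv, polyDim_singleton] at hdim
    lia
  have hcard := hss _ hface τ h1 h2 h3
  have hτ : polyDim τ ≤ n := by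
    simpa [polyDim] using Submodule.finrank_le (vectorSpan ℝ τ)
  rw [hdim, Nat.sub_eq_zero_of_le hτ, zero_add, ncard_eq_one] at hcard
  obtain ⟨a, ha⟩ := hcard
  have hi : i ∈ ({a} : Set (Fin N)) := ha ▸ (Or.inl rfl : IsFaceOf (Γ.pieces i) (Γ.pieces i))
  have hj : j ∈ ({a} : Set (Fin N)) := ha ▸ (Or.inl hij : IsFaceOf (Γ.pieces i) (Γ.pieces j))
  exact hi.trans hj.symm

/-- A piece is determined by its edges at a vertex. -/
theorem IsSemiStable.eq_of_edges_subset {Γ : SimplicialPartition n n N Δ}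
    (hss : IsSemiStable Γ) (hn : 1 ≤ n) {p : Fin n → ℝ} {i j : Fin N}
    (hi : IsVertexOf p (Γ.pieces i)) (hj : IsVertexOf p (Γ.pieces j))
    (h : ∀ e, IsEdgeOf e (Γ.pieces i) → p ∈ e → e ⊆ Γ.pieces j) : i = j := by
  by_contra hij
  have hne : (Γ.pieces i ∩ Γ.pieces j).Nonempty :=
    ⟨p, hi.mem_extremePoints.1, hj.mem_extremePoints.1⟩
  rcases Γ.common_face i j hij with h0 | ⟨h1, h2⟩
  · exact hne.ne_empty h0
  have hd := dim_le_polyDim_add_card (Γ.piece_rat i) (Γ.piece_dim i) hi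
    (Γ.pieces i ∩ Γ.pieces j) ∅
    (fun e he hpe => Or.inl (subset_inter he.1.subset (h e he hpe))) (by simp)
  rw [Finset.card_empty, add_zero] at hd
  have e1 := h1.eq_of_polyDim_le Subset.rfl inter_subset_left hne ((Γ.piece_dim i).trans_le hd)
  have e2 := h2.eq_of_polyDim_le Subset.rfl inter_subset_right hne ((Γ.piece_dim j).trans_le hd)
  exact hij (hss.pieces_injective hn (e1.symm.trans e2))

/-- at any vertex of a semi-stable simplicial partition of an `n`-dimensional
simplicial rational polytope there are exactly `n + 1` edges of the partition. -/
theorem edge_count_at_gamma_vertex {n N : ℕ} (hn : 1 ≤ n) {Δ : Set (Fin n → ℝ)}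
    (hΔrat : IsRatPolytope Δ) (hΔdim : polyDim Δ = n) (hΔsimp : IsSimplicial n Δ)
    (Γ : SimplicialPartition n n N Δ) (hss : IsSemiStable Γ)
    (p : Fin n → ℝ) (hp : IsGammaVertex Γ p) :
    {e | IsGammaEdge Γ e ∧ p ∈ e}.ncard = n + 1 := by
  classical
  obtain ⟨⟨j₀, hj₀⟩, hpΔ⟩ := hp
  have hpmem : p ∈ Γ.pieces j₀ := hj₀.mem_extremePoints.1
  obtain ⟨τ, hτ, hpτ, hτmin⟩ := exists_least_face (singleton_nonempty p)
    (singleton_subset_iff.2 (Γ.piece_subset j₀ hpmem))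
  rw [singleton_subset_iff] at hpτ
  set l := polyDim τ with hl
  set J : Finset (Fin N) := {j | IsVertexOf p (Γ.pieces j)} with hJ
  have hJcard : J.card = l + 1 := by
    have h := hss {p} ⟨⟨j₀, hj₀⟩, fun v hv => by rwa [← singleton_eq_singleton_iff.1 hv]⟩ τ hτ
      (singleton_subset_iff.2 hpτ) hτmin
    rw [polyDim_singleton, Nat.sub_zero] at h
    rw [← h, ← Set.ncard_coe_finset]
    congr 1
    ext j
    rw [hJ, Finset.mem_coe, Finset.mem_filter_univ]
    rfl
  have hlpos : 0 < l := by
    rw [Nat.pos_iff_ne_zero]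
    intro h0
    have hsub : τ = {p} := by
      refine Subset.antisymm (fun x hx => ?_) (singleton_subset_iff.2 hpτ)
      have h1 := vsub_mem_vectorSpan ℝ hx hpτ
      rw [Submodule.finrank_eq_zero.1 (hl.symm.trans h0)] at h1
      exact sub_eq_zero.1 h1
    exact hpΔ (by rwa [hsub] at hτ)
  have hmemJ : ∀ {j e}, IsFaceOf e (Γ.pieces j) → p ∈ e → j ∈ J := fun h hpe => by
    simpa [hJ] using Γ.isVertexOf_of_mem hj₀ (h.subset hpe)
  have hncard : ∀ j ∈ J, {e | IsEdgeOf e (Γ.pieces j) ∧ p ∈ e}.ncard = n := fun j hj =>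
    Γ.piece_simplicial j p (by simpa [hJ] using hj)
  have hEfin : {e | IsGammaEdge Γ e ∧ p ∈ e}.Finite := by
    refine (J.finite_toSet.biUnion (t := fun j => {e | IsEdgeOf e (Γ.pieces j) ∧ p ∈ e})
      fun j hj => finite_of_ncard_pos (by rw [hncard j hj]; lia)).subset ?_
    rintro e ⟨⟨⟨j, hj⟩, h1⟩, hpe⟩
    exact mem_biUnion (hmemJ hj hpe) ⟨⟨hj, h1⟩, hpe⟩
  set E := hEfin.toFinset with hE
  have hmemE : ∀ e, e ∈ E ↔ IsGammaEdge Γ e ∧ p ∈ e := fun e => by simp [hE]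
  set deg : Set (Fin n → ℝ) → ℕ := fun e => {j ∈ J | IsFaceOf e (Γ.pieces j)}.card
  have hdegle : ∀ e, deg e ≤ l + 1 := fun e => hJcard ▸ Finset.card_filter_le _ _
  have hdegτ : ∀ e ∈ E, (e ⊆ τ → deg e = l) ∧ (¬ e ⊆ τ → deg e = l + 1) := by
    intro e he
    obtain ⟨⟨⟨j, hj⟩, h1⟩, hpe⟩ := (hmemE e).1 he
    obtain ⟨ρ, hρ, heρ, hρmin⟩ := exists_least_face ⟨p, hpe⟩
      (hj.subset.trans (Γ.piece_subset j))
    have hτρ : τ ⊆ ρ := hτmin ρ hρ (singleton_subset_iff.2 (heρ hpe))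
    have h2 := hss e ⟨⟨j, hj⟩, fun v hv => absurd hv (IsEdgeOf.not_singleton ⟨hj, h1⟩ v)⟩
      ρ hρ heρ hρmin
    have h3 : polyDim e ≤ polyDim ρ := polyDim_mono heρ
    have h4 : deg e = polyDim ρ := by
      rw [h1] at h2 h3
      rw [Nat.sub_add_cancel h3] at h2
      rw [← h2]
      change Finset.card _ = _
      rw [← Set.ncard_coe_finset]
      congr 1
      ext i
      simpa using fun h => hmemJ h hpe
    refine ⟨fun h => ?_, fun h => ?_⟩
    · rw [h4, (hρmin τ hτ h).antisymm hτρ]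
    · have h5 : ¬ polyDim ρ ≤ polyDim τ := fun h6 =>
        h (hτ.eq_of_polyDim_le hρ.subset hτρ ⟨p, hpτ⟩ h6 ▸ heρ)
      have := hdegle e
      lia
  set A := {e ∈ E | e ⊆ τ}
  set B := {e ∈ E | ¬ e ⊆ τ} with hB
  have hBall : ∀ e ∈ B, ∀ j ∈ J, IsFaceOf e (Γ.pieces j) := by
    intro e he
    rw [hB, Finset.mem_filter] at he
    have := (hdegτ e he.1).2 he.2
    rw [← hJcard] at this
    exact Finset.card_filter_eq_iff.1 this
  have hpiece : ∀ j ∈ J, {e ∈ E | IsFaceOf e (Γ.pieces j)}.card = n := by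
    intro j hj
    refine Eq.trans ?_ (hncard j hj)
    rw [← Set.ncard_coe_finset]
    congr 1
    ext e
    simp only [Finset.coe_filter, mem_ofPred_eq, hmemE, IsGammaEdge, IsEdgeOf]
    exact ⟨fun h => ⟨⟨h.2, h.1.1.2⟩, h.1.2⟩, fun h => ⟨⟨⟨⟨j, h.1.1⟩, h.1.2⟩, h.2⟩, h.1.1⟩⟩
  have hcount : A.card * l + B.card * (l + 1) = (l + 1) * n := by
    have h1 := Finset.sum_card_bipartiteAbove_eq_sum_card_bipartiteBelow
      (s := E) (t := J) (fun e j => IsFaceOf e (Γ.pieces j))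
    have h2 : ∑ j ∈ J, (E.bipartiteBelow (fun e j => IsFaceOf e (Γ.pieces j)) j).card
        = (l + 1) * n := by
      rw [← hJcard, ← smul_eq_mul]
      exact Finset.sum_eq_card_nsmul hpiece
    rw [← h2, ← h1, ← Finset.sum_filter_add_sum_filter_not E (fun e => e ⊆ τ)]
    congr 1
    · refine (Finset.sum_const_nat fun e he => ?_).symm
      exact (hdegτ e (Finset.mem_filter.1 he).1).1 (Finset.mem_filter.1 he).2
    · refine (Finset.sum_const_nat fun e he => ?_).symm
      exact (hdegτ e (Finset.mem_filter.1 he).1).2 (Finset.mem_filter.1 he).2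
  have hj₀J : j₀ ∈ J := by simpa [hJ] using hj₀
  have hBsub : B ⊆ {e ∈ E | IsFaceOf e (Γ.pieces j₀)} := fun e he =>
    Finset.mem_filter.2 ⟨(Finset.mem_filter.1 he).1, hBall e he j₀ hj₀J⟩
  have hedgeE : ∀ e, IsEdgeOf e (Γ.pieces j₀) → p ∈ e → e ∈ E := fun e he hpe =>
    (hmemE e).2 ⟨⟨⟨j₀, he.1⟩, he.2⟩, hpe⟩
  have hlower : n ≤ l + B.card := by
    refine dim_le_polyDim_add_card (Γ.piece_rat j₀) (Γ.piece_dim j₀) hj₀ τ B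
      (fun e he hpe => ?_) fun e he => ?_
    · by_cases h : e ⊆ τ
      · exact Or.inl h
      · exact Or.inr (Finset.mem_filter.2 ⟨hedgeE e he hpe, h⟩)
    · exact ((hmemE e).1 (Finset.mem_filter.1 he).1).1.2
  have hupper : B.card < n := by
    have hle : B.card ≤ n := (Finset.card_le_card hBsub).trans_eq (hpiece j₀ hj₀J)
    refine lt_of_le_of_ne hle fun hBn => ?_
    have hBeq := Finset.eq_of_subset_of_card_le hBsub (by rw [hpiece j₀ hj₀J, hBn])
    obtain ⟨j, hj, hjne⟩ := Finset.exists_mem_ne (by lia : 1 < J.card) j₀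
    refine hjne (hss.eq_of_edges_subset hn hj₀ (by simpa [hJ] using hj) fun e he hpe => ?_).symm
    refine (hBall e ?_ j hj).subset
    rw [hBeq]
    exact Finset.mem_filter.2 ⟨hedgeE e he hpe, he.1⟩
  have hABE : A.card + B.card = E.card := Finset.card_filter_add_card_filter_not _
  rw [ncard_eq_toFinset_card _ hEfin, ← hE, ← hABE]
  obtain ⟨m, hm⟩ := Nat.exists_eq_add_of_lt hupper
  have hmul : A.card * l = (l + 1) * (m + 1) := by
    have : (l + 1) * n = (l + 1) * (B.card + m + 1) := congrArg _ hm
    linarith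
  have hdvd : l ∣ m + 1 := by
    refine Nat.Coprime.dvd_of_dvd_mul_left (k := l) (m := l + 1) (Nat.coprime_self_add_right.2 (Nat.coprime_one_right l)) ?_
    exact hmul ▸ dvd_mul_left _ _
  have hml : m + 1 = l := le_antisymm (by lia) (Nat.le_of_dvd (Nat.succ_pos m) hdvd)
  rw [hml] at hmul
  have hAl : A.card = l + 1 := Nat.eq_of_mul_eq_mul_right hlpos hmul
  lia
end
end

section
/- Let n ≥ 1 and f₀, f₁, …, f_n ∈ ℤⁿ be such that every n-element subset of {f₀, f₁, …, f_n} is a ℤ-basis of ℤⁿ. If f₀ = Σ_{i=1}^n vᵢ fᵢ with vᵢ ∈ ℤ, then vᵢ ∈ {1, −1} for every i = 1, …, n. -/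
/-- if `f₀, …, f_n ∈ ℤⁿ` are such that every `n`-element subset of them is a
`ℤ`-basis of `ℤⁿ`, and `f₀ = ∑ᵢ vᵢ fᵢ` with integer coefficients, then each `vᵢ = ±1`. -/
theorem coeffs_pm_one_of_all_subbases (n : ℕ) (hn : 1 ≤ n)
    (f : Fin (n + 1) → (Fin n → ℤ))
    (hbasis : ∀ j : Fin (n + 1),
      Submodule.span ℤ (Set.range fun i : {i : Fin (n + 1) // i ≠ j} => f i) = ⊤)
    (v : Fin n → ℤ) (hv : f 0 = ∑ i : Fin n, v i • f i.succ) :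
    ∀ i, v i = 1 ∨ v i = -1 := by
  intro i
  have hsurj : Function.Surjective (Fintype.linearCombination ℤ fun k : Fin n => f k.succ) := by
    rw [← LinearMap.range_eq_top, Fintype.range_linearCombination, eq_top_iff, ← hbasis 0]
    refine Submodule.span_mono ?_
    rintro _ ⟨⟨j, hj⟩, rfl⟩
    exact ⟨j.pred hj, by simp⟩
  let e := LinearEquiv.ofBijective _
    ⟨OrzechProperty.injective_of_surjective_endomorphism _ hsurj, hsurj⟩
  let φ : (Fin n → ℤ) →ₗ[ℤ] ℤ := LinearMap.proj i ∘ₗ e.symm.toLinearMap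
  have hφ (k : Fin n) : φ (f k.succ) = (Pi.single k 1 : Fin n → ℤ) i := by
    have : e.symm (f k.succ) = Pi.single k 1 := by
      rw [LinearEquiv.symm_apply_eq]
      change _ = Fintype.linearCombination ℤ (fun k : Fin n => f k.succ) (Pi.single k 1)
      rw [Fintype.linearCombination_apply_single, one_smul]
    simp [φ, this]
  have hφ0 : φ (f 0) = v i := by
    simp only [hv, map_sum, map_smul, hφ]
    simp [Pi.single_apply]
  have hle : (⊤ : Submodule ℤ (Fin n → ℤ)) ≤ Submodule.comap φ (Ideal.span {v i}) := by
    rw [← hbasis i.succ, Submodule.span_le]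
    rintro _ ⟨⟨j, hj⟩, rfl⟩
    change φ (f j) ∈ Ideal.span {v i}
    rw [Ideal.mem_span_singleton]
    cases j using Fin.cases with
    | zero => rw [hφ0]
    | succ k =>
      have hk : i ≠ k := fun h => hj (by rw [h])
      rw [hφ, Pi.single_eq_of_ne hk]
      exact dvd_zero _
  have hdvd : v i ∣ 1 := by
    have h := hle (Submodule.mem_top (x := f i.succ))
    rw [Submodule.mem_comap, hφ, Pi.single_eq_same] at h
    exact Ideal.mem_span_singleton.mp h
  exact Int.isUnit_iff.mp (isUnit_of_dvd_one hdvd)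
end
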